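/- Every lattice d-simplex of normalized volume V ≥ 2 can be written, modulo the subdivision relations and lower-dimensional polytopes, as an integer combination of lattice d-simplices each of normalized volume strictly less than V. -/

import Mathlib

/- Statement 6: every lattice d-simplex of normalized volume V ≥ 2 can be written, modulo
the subdivision relations and polytopes of dimension < d, as an integer combination of
lattice d-simplices each of normalized volume strictly less than V. -/

open Classical Polynomial Pointwise
noncomputable section

abbrev Euc (n : ℕ) := Fin n → ℝ

def IsPolytope {n : ℕ} (P : Set (Euc n)) : Prop :=
  ∃ V : Finset (Euc n), P = convexHull ℝ (V : Set (Euc n))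

def intPt {n : ℕ} (v : Fin n → ℤ) : Euc n := fun i => (v i : ℝ)

def IsLatticePolytope {n : ℕ} (P : Set (Euc n)) : Prop :=
  ∃ V : Finset (Fin n → ℤ), P = convexHull ℝ (intPt '' (V : Set (Fin n → ℤ)))

def latticePts {n : ℕ} (P : Set (Euc n)) : Set (Fin n → ℤ) := {v | intPt v ∈ P}

def pdim {n : ℕ} (P : Set (Euc n)) : ℕ := Module.finrank ℝ (vectorSpan ℝ P)

def relBoundary {n : ℕ} (P : Set (Euc n)) : Set (Euc n) := P \ intrinsicInterior ℝ P

structure Subdivision {n : ℕ} (P : Set (Euc n)) where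
  cells : Finset (Set (Euc n))
  nonempty_cells : ∀ F ∈ cells, (F : Set (Euc n)).Nonempty
  poly : ∀ F ∈ cells, IsPolytope F
  cover : (⋃ F ∈ cells, F) = P
  inter_face : ∀ F ∈ cells, ∀ G ∈ cells, IsExposed ℝ F (F ∩ G) ∧ IsExposed ℝ G (F ∩ G)
  face_mem : ∀ F ∈ cells, ∀ G : Set (Euc n), IsExposed ℝ F G → G.Nonempty → G ∈ cells

def liftedPts {n : ℕ} (P : Set (Euc n)) (ω : (Fin n → ℤ) → ℝ) : Set (Euc n × ℝ) :=
  {p | ∃ v ∈ latticePts P, p = (intPt v, ω v)}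

def lowerEnv {n : ℕ} (P : Set (Euc n)) (ω : (Fin n → ℤ) → ℝ) (x : Euc n) : ℝ :=
  sInf {t | (x, t) ∈ convexHull ℝ (liftedPts P ω)}

def IsRegularCell {n : ℕ} (P : Set (Euc n)) (ω : (Fin n → ℤ) → ℝ) (F : Set (Euc n)) :
    Prop :=
  F.Nonempty ∧ ∃ a : Euc n →ᵃ[ℝ] ℝ, (∀ x ∈ P, a x ≤ lowerEnv P ω x) ∧
    F = {x ∈ P | a x = lowerEnv P ω x}

def IsRegularSubdivision {n : ℕ} (P : Set (Euc n)) (S : Subdivision P) : Prop :=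
  ∃ ω : (Fin n → ℤ) → ℝ, (↑S.cells : Set (Set (Euc n))) = {F | IsRegularCell P ω F}

def unimodMap {n : ℕ} (A : Matrix (Fin n) (Fin n) ℤ) (u : Fin n → ℤ) (x : Euc n) :
    Euc n :=
  (A.map (Int.cast : ℤ → ℝ)).mulVec x + intPt u

def stdSimplexSet (n k : ℕ) : Set (Euc n) :=
  convexHull ℝ (insert 0
    (Set.range fun j : Fin k => fun i : Fin n => if (i : ℕ) = (j : ℕ) then (1 : ℝ) else 0))

def IsUnimodularSimplex {n : ℕ} (P : Set (Euc n)) : Prop :=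
  ∃ k : ℕ, k ≤ n ∧ ∃ A : Matrix (Fin n) (Fin n) ℤ, IsUnit A.det ∧ ∃ u : Fin n → ℤ,
    P = unimodMap A u '' stdSimplexSet n k

/-- Generators of the subgroup H of the free abelian group on lattice polytopes:
subdivision relations for regular lattice subdivisions, the empty polytope, and
unimodular equivalences. -/
def relationSet (n : ℕ) : Set (FreeAbelianGroup (Set (Euc n))) :=
  {x | (∃ P : Set (Euc n), ∃ S : Subdivision P, IsLatticePolytope P ∧
          (∀ F ∈ S.cells, IsLatticePolytope F) ∧ IsRegularSubdivision P S ∧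
          x = FreeAbelianGroup.of P - ∑ F ∈ S.cells,
            (if F ⊆ relBoundary P then 0
             else ((-1 : ℤ) ^ (pdim P - pdim F)) • FreeAbelianGroup.of F))
    ∨ x = FreeAbelianGroup.of (∅ : Set (Euc n))
    ∨ (∃ P : Set (Euc n), ∃ A : Matrix (Fin n) (Fin n) ℤ, ∃ u : Fin n → ℤ,
          IsLatticePolytope P ∧ IsUnit A.det ∧
          x = FreeAbelianGroup.of (unimodMap A u '' P) - FreeAbelianGroup.of P)}

/-- The lattice simplex spanned by the vertices v 0, …, v d in ℝ^d. -/
def simplexOf {d : ℕ} (v : Fin (d + 1) → (Fin d → ℤ)) : Set (Euc d) :=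
  convexHull ℝ (Set.range fun k => intPt (v k))

/-- The normalized volume (d! times Euclidean volume) of the lattice simplex with
vertices v 0, …, v d. -/
def normVol {d : ℕ} (v : Fin (d + 1) → (Fin d → ℤ)) : ℕ :=
  (Matrix.det (Matrix.of fun i j : Fin d => v i.succ j - v 0 j)).natAbs

/-- Generators for lower-dimensional lattice polytopes. -/
def lowDimSet (d : ℕ) : Set (FreeAbelianGroup (Set (Euc d))) :=
  {x | ∃ P : Set (Euc d), IsLatticePolytope P ∧ pdim P < d ∧
        x = FreeAbelianGroup.of P}

lemma latticePts_finite {n : ℕ} {P : Set (Euc n)} (hP : IsLatticePolytope P) :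
    (latticePts P).Finite := by
  obtain ⟨V, rfl⟩ := hP
  have hc : IsCompact (convexHull ℝ (intPt '' (V : Set (Fin n → ℤ)))) :=
    (V.finite_toSet.image intPt).isCompact_convexHull (𝕜 := ℝ)
  obtain ⟨R, hR⟩ := hc.isBounded.exists_norm_le
  refine (Set.Finite.pi' (t := fun _ : Fin n => Set.Icc (-⌈R⌉) ⌈R⌉)
    (fun _ => Set.finite_Icc _ _)).subset ?_
  intro v hv i
  have h1 := (norm_le_pi_norm (intPt v) i).trans (hR _ hv)
  simp only [intPt, Real.norm_eq_abs] at h1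
  have h2 := abs_le.1 (h1.trans (Int.le_ceil R))
  constructor
  · exact_mod_cast h2.1
  · exact_mod_cast h2.2

lemma subset_hull_latticePts {n : ℕ} {P : Set (Euc n)} (hP : IsLatticePolytope P) :
    P = convexHull ℝ (intPt '' latticePts P) := by
  apply Set.Subset.antisymm
  · obtain ⟨V, rfl⟩ := hP
    apply convexHull_mono
    apply Set.image_mono
    intro v hv
    exact subset_convexHull ℝ _ ⟨v, hv, rfl⟩
  · apply convexHull_min
    · rintro _ ⟨v, hv, rfl⟩; exact hv
    · obtain ⟨V, rfl⟩ := hP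
      exact convex_convexHull ℝ _

/-- lattice points on which the affine function is active -/
def active {n : ℕ} (P : Set (Euc n)) (ω : (Fin n → ℤ) → ℝ) (a : Euc n →ᵃ[ℝ] ℝ) :
    Set (Fin n → ℤ) := {v | v ∈ latticePts P ∧ a (intPt v) = ω v}

lemma aff_comb {E : Type*} [AddCommGroup E] [Module ℝ E] (a : E →ᵃ[ℝ] ℝ) (x y : E) (s t : ℝ)
    (h : s + t = 1) : a (s • x + t • y) = s * a x + t * a y := by
  have := Convex.combo_affine_apply (f := a) (x := x) (y := y) h
  simpa using this

lemma lifted_key {n : ℕ} {P : Set (Euc n)} {ω : (Fin n → ℤ) → ℝ} {a : Euc n →ᵃ[ℝ] ℝ}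
    (ha : ∀ v ∈ latticePts P, a (intPt v) ≤ ω v) {y : Euc n × ℝ}
    (hy : y ∈ convexHull ℝ (liftedPts P ω)) :
    a y.1 ≤ y.2 ∧ (a y.1 = y.2 → y.1 ∈ convexHull ℝ (intPt '' active P ω a)) := by
  have : convexHull ℝ (liftedPts P ω) ⊆ {y : Euc n × ℝ | a y.1 ≤ y.2 ∧
      (a y.1 = y.2 → y.1 ∈ convexHull ℝ (intPt '' active P ω a))} := by
    apply convexHull_min
    · rintro _ ⟨v, hv, rfl⟩
      exact ⟨ha v hv, fun h => subset_convexHull ℝ _ ⟨v, ⟨hv, h⟩, rfl⟩⟩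
    · rw [convex_iff_forall_pos]
      rintro ⟨x, t⟩ ⟨h1, h2⟩ ⟨x', t'⟩ ⟨h3, h4⟩ s s' hs hs' hss
      simp only at h1 h2 h3 h4
      have e : a (s • x + s' • x') = s * a x + s' * a x' := aff_comb a x x' s s' hss
      simp only [Set.mem_ofPred_eq, Prod.smul_mk, Prod.mk_add_mk, smul_eq_mul, e]
      have k1 : s * a x ≤ s * t := mul_le_mul_of_nonneg_left h1 hs.le
      have k2 : s' * a x' ≤ s' * t' := mul_le_mul_of_nonneg_left h3 hs'.le
      refine ⟨by linarith, fun h => ?_⟩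
      have e1 : s * a x = s * t := by linarith
      have e2 : s' * a x' = s' * t' := by linarith
      exact convex_convexHull ℝ _ (h2 (mul_left_cancel₀ hs.ne' e1))
        (h4 (mul_left_cancel₀ hs'.ne' e2)) hs.le hs'.le hss
  exact this hy

lemma lowerEnv_compact {n : ℕ} {P : Set (Euc n)} (hP : IsLatticePolytope P)
    (ω : (Fin n → ℤ) → ℝ) (x : Euc n) :
    IsCompact {t | (x, t) ∈ convexHull ℝ (liftedPts P ω)} := by
  have hf : (liftedPts P ω).Finite := by
    refine ((latticePts_finite hP).image (fun v => (intPt v, ω v))).subset ?_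
    rintro _ ⟨v, hv, rfl⟩
    exact ⟨v, hv, rfl⟩
  have hc := hf.isCompact_convexHull (𝕜 := ℝ)
  have : {t | (x, t) ∈ convexHull ℝ (liftedPts P ω)} =
      Prod.snd '' (convexHull ℝ (liftedPts P ω) ∩ Prod.fst ⁻¹' {x}) := by
    ext t
    constructor
    · intro h; exact ⟨(x, t), ⟨h, rfl⟩, rfl⟩
    · rintro ⟨⟨x', t'⟩, ⟨h, h'⟩, rfl⟩
      simp only [Set.mem_preimage, Set.mem_singleton_iff] at h'
      subst h'; exact h
  rw [this]
  exact (hc.inter_right (isClosed_singleton.preimage continuous_fst)).image continuous_snd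

lemma lowerEnv_mem {n : ℕ} {P : Set (Euc n)} (hP : IsLatticePolytope P)
    (ω : (Fin n → ℤ) → ℝ) {x : Euc n} (hx : x ∈ P) :
    (x, lowerEnv P ω x) ∈ convexHull ℝ (liftedPts P ω) := by
  refine (lowerEnv_compact hP ω x).sInf_mem ?_
  rw [subset_hull_latticePts hP] at hx
  have e : intPt '' latticePts P = (LinearMap.fst ℝ (Euc n) ℝ) '' liftedPts P ω := by
    ext y
    constructor
    · rintro ⟨v, hv, rfl⟩; exact ⟨_, ⟨v, hv, rfl⟩, rfl⟩
    · rintro ⟨_, ⟨v, hv, rfl⟩, rfl⟩; exact ⟨v, hv, rfl⟩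
  rw [e, ← LinearMap.image_convexHull] at hx
  obtain ⟨⟨x', t⟩, h, rfl⟩ := hx
  exact ⟨t, h⟩

lemma lowerEnv_le {n : ℕ} {P : Set (Euc n)} (hP : IsLatticePolytope P)
    (ω : (Fin n → ℤ) → ℝ) {x : Euc n} {t : ℝ} (h : (x, t) ∈ convexHull ℝ (liftedPts P ω)) :
    lowerEnv P ω x ≤ t :=
  csInf_le (lowerEnv_compact hP ω x).bddBelow h

lemma lowerEnv_le_omega {n : ℕ} {P : Set (Euc n)} (hP : IsLatticePolytope P)
    (ω : (Fin n → ℤ) → ℝ) {v : Fin n → ℤ} (hv : v ∈ latticePts P) :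
    lowerEnv P ω (intPt v) ≤ ω v :=
  lowerEnv_le hP ω (subset_convexHull ℝ _ ⟨v, hv, rfl⟩)

lemma le_lowerEnv_iff {n : ℕ} {P : Set (Euc n)} (hP : IsLatticePolytope P)
    (ω : (Fin n → ℤ) → ℝ) (a : Euc n →ᵃ[ℝ] ℝ) :
    (∀ x ∈ P, a x ≤ lowerEnv P ω x) ↔ ∀ v ∈ latticePts P, a (intPt v) ≤ ω v := by
  constructor
  · intro h v hv
    exact (h _ hv).trans (lowerEnv_le_omega hP ω hv)
  · intro h x hx
    exact (lifted_key h (lowerEnv_mem hP ω hx)).1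

lemma cell_eq {n : ℕ} {P : Set (Euc n)} (hP : IsLatticePolytope P)
    (ω : (Fin n → ℤ) → ℝ) (a : Euc n →ᵃ[ℝ] ℝ)
    (ha : ∀ v ∈ latticePts P, a (intPt v) ≤ ω v) :
    {x ∈ P | a x = lowerEnv P ω x} = convexHull ℝ (intPt '' active P ω a) := by
  apply Set.Subset.antisymm
  · rintro x ⟨hx, e⟩
    exact (lifted_key ha (lowerEnv_mem hP ω hx)).2 e
  · intro x hx
    have hxP : x ∈ P := by
      rw [subset_hull_latticePts hP]
      exact convexHull_mono (Set.image_mono fun v hv => hv.1) hx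
    refine ⟨hxP, le_antisymm ((le_lowerEnv_iff hP ω a).2 ha x hxP) ?_⟩
    apply lowerEnv_le hP
    have : convexHull ℝ (intPt '' active P ω a) ⊆
        {x | (x, a x) ∈ convexHull ℝ (liftedPts P ω)} := by
      apply convexHull_min
      · rintro _ ⟨v, hv, rfl⟩
        exact subset_convexHull ℝ _ ⟨v, hv.1, by rw [hv.2]⟩
      · intro x hx y hy s t hs ht hst
        have := convex_convexHull ℝ _ hx hy hs ht hst
        simpa [aff_comb a x y s t hst] using this
    exact this hx

lemma regCell_iff {n : ℕ} {P : Set (Euc n)} (hP : IsLatticePolytope P)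
    (ω : (Fin n → ℤ) → ℝ) (F : Set (Euc n)) :
    IsRegularCell P ω F ↔ F.Nonempty ∧ ∃ a : Euc n →ᵃ[ℝ] ℝ,
      (∀ v ∈ latticePts P, a (intPt v) ≤ ω v) ∧ F = convexHull ℝ (intPt '' active P ω a) := by
  unfold IsRegularCell
  refine and_congr_right fun _ => exists_congr fun a => ?_
  rw [le_lowerEnv_iff hP]
  refine and_congr_right fun ha => ?_
  rw [cell_eq hP ω a ha]

lemma regCell_lattice {n : ℕ} {P : Set (Euc n)} (hP : IsLatticePolytope P)
    (ω : (Fin n → ℤ) → ℝ) {F : Set (Euc n)} (hF : IsRegularCell P ω F) :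
    IsLatticePolytope F := by
  obtain ⟨-, a, -, rfl⟩ := (regCell_iff hP ω F).1 hF
  have hf : (active P ω a).Finite := (latticePts_finite hP).subset fun v hv => hv.1
  exact ⟨hf.toFinset, by simp⟩

lemma lattice_poly {n : ℕ} {P : Set (Euc n)} (hP : IsLatticePolytope P) : IsPolytope P := by
  obtain ⟨V, rfl⟩ := hP
  exact ⟨V.image intPt, by simp⟩

lemma regCell_finite {n : ℕ} {P : Set (Euc n)} (hP : IsLatticePolytope P)
    (ω : (Fin n → ℤ) → ℝ) : {F | IsRegularCell P ω F}.Finite := by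
  refine ((latticePts_finite hP).finite_subsets.image
    (fun A => convexHull ℝ (intPt '' A))).subset ?_
  intro F hF
  obtain ⟨-, a, -, rfl⟩ := (regCell_iff hP ω F).1 hF
  exact ⟨active P ω a, fun v hv => hv.1, rfl⟩

lemma regCell_inter {n : ℕ} {P : Set (Euc n)}
    (ω : (Fin n → ℤ) → ℝ) {F G : Set (Euc n)} (hF : IsRegularCell P ω F)
    (hG : IsRegularCell P ω G) : IsExposed ℝ F (F ∩ G) := by
  obtain ⟨-, a, ha, rfl⟩ := hF
  obtain ⟨-, b, hb, rfl⟩ := hG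
  rintro ⟨x0, ⟨hx0, h1⟩, -, h2⟩
  have key : ∀ x, (b - a) x = (b - a).linear x + (b - a) 0 := fun x => by
    have := congrFun (b - a).decomp x
    simpa using this
  have lin : ∀ x, b x - a x = LinearMap.toContinuousLinearMap (b - a).linear x + (b 0 - a 0) := by
    intro x
    simpa using key x
  refine ⟨LinearMap.toContinuousLinearMap (b - a).linear, ?_⟩
  ext x
  constructor
  · rintro ⟨⟨hx, e1⟩, -, e2⟩
    refine ⟨⟨hx, e1⟩, ?_⟩
    rintro y ⟨hy, e3⟩
    have := lin x; have := lin y; have := hb y hy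
    linarith
  · rintro ⟨⟨hx, e1⟩, h⟩
    refine ⟨⟨hx, e1⟩, hx, ?_⟩
    have h3 := h x0 ⟨hx0, h1⟩
    have := lin x; have := lin x0; have := hb x hx
    linarith

lemma regCell_face {n : ℕ} {P : Set (Euc n)} (hP : IsLatticePolytope P)
    (ω : (Fin n → ℤ) → ℝ) {F G : Set (Euc n)} (hF : IsRegularCell P ω F)
    (hG : IsExposed ℝ F G) (hne : G.Nonempty) : IsRegularCell P ω G := by
  have hconvG : Convex ℝ G := by
    refine hG.convex ?_
    obtain ⟨V, rfl⟩ := regCell_lattice hP ω hF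
    exact convex_convexHull ℝ _
  obtain ⟨-, a, ha0, rfl⟩ := hF
  have ha := (le_lowerEnv_iff hP ω a).1 ha0
  obtain ⟨l, hl⟩ := hG hne
  obtain ⟨x0, hx0⟩ := hne
  have hx0' := hx0
  rw [hl] at hx0'
  have hlx : ∀ x ∈ G, l x = l x0 := by
    intro x hx
    have hx' := hx
    rw [hl] at hx'
    exact le_antisymm (hx0'.2 x hx'.1) (hx'.2 x0 hx0'.1)
  have hact : ∀ v ∈ latticePts P, a (intPt v) = ω v →
      intPt v ∈ {x ∈ P | a x = lowerEnv P ω x} := by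
    intro v hv e
    refine ⟨hv, le_antisymm (ha0 _ hv) ?_⟩
    rw [e]; exact lowerEnv_le_omega hP ω hv
  obtain ⟨ε, hε, hε0⟩ : ∃ ε : ℝ, (∀ v ∈ latticePts P, a (intPt v) ≠ ω v →
      ε * (l (intPt v) - l x0) < ω v - a (intPt v)) ∧ 0 < ε := by
    have h1 : ∀ᶠ ε : ℝ in nhdsWithin 0 (Set.Ioi 0), ∀ v ∈ latticePts P, a (intPt v) ≠ ω v →
      ε * (l (intPt v) - l x0) < ω v - a (intPt v) := by
      rw [Filter.eventually_all_finite (latticePts_finite hP)]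
      intro v hv
      rw [Filter.eventually_imp_distrib_left]
      intro hne
      have hpos : 0 < ω v - a (intPt v) := sub_pos.2 (lt_of_le_of_ne (ha v hv) hne)
      apply nhdsWithin_le_nhds
      have : Continuous fun ε : ℝ => ε * (l (intPt v) - l x0) := by fun_prop
      exact this.continuousAt.eventually_lt_const (by simpa using hpos)
    exact (h1.and self_mem_nhdsWithin).exists
  set a' : Euc n →ᵃ[ℝ] ℝ := a + ε • (l.toLinearMap.toAffineMap - AffineMap.const ℝ _ (l x0))
    with ha'
  have ea : ∀ x, a' x = a x + ε * (l x - l x0) := by intro x; simp [ha']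
  have hle : ∀ v ∈ latticePts P, a' (intPt v) ≤ ω v := by
    intro v hv
    rw [ea]
    by_cases e : a (intPt v) = ω v
    · have := hx0'.2 _ (hact v hv e)
      have := mul_nonneg hε0.le (sub_nonneg.2 this)
      linarith
    · have := hε v hv e; linarith
  refine (regCell_iff hP ω G).2 ⟨⟨x0, hx0⟩, a', hle, ?_⟩
  apply Set.Subset.antisymm
  · rw [← cell_eq hP ω a' hle]
    intro x hx
    have h1 := hlx x hx
    rw [hl] at hx
    refine ⟨hx.1.1, ?_⟩
    rw [ea, h1, ← hx.1.2]; ring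
  · refine convexHull_min ?_ hconvG
    rintro _ ⟨v, ⟨hv, e⟩, rfl⟩
    rw [ea] at e
    by_cases e' : a (intPt v) = ω v
    · have h2 : ε * (l (intPt v) - l x0) = 0 := by linarith
      have h3 : l (intPt v) = l x0 := by
        rcases mul_eq_zero.1 h2 with h | h <;> linarith
      rw [hl]
      refine ⟨hact v hv e', fun y hy => ?_⟩
      rw [h3]; exact hx0'.2 y hy
    · have := hε v hv e'; linarith

/-- The regular subdivision attached to a weight, provided that the cells cover. -/
def regSub {n : ℕ} {P : Set (Euc n)} (hP : IsLatticePolytope P) (ω : (Fin n → ℤ) → ℝ)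
    (hcov : ∀ x ∈ P, ∃ F, IsRegularCell P ω F ∧ x ∈ F) : Subdivision P where
  cells := (regCell_finite hP ω).toFinset
  nonempty_cells := by
    intro F hF
    rw [Set.Finite.mem_toFinset] at hF
    exact hF.1
  poly := by
    intro F hF
    rw [Set.Finite.mem_toFinset] at hF
    exact lattice_poly (regCell_lattice hP ω hF)
  cover := by
    ext x
    simp only [Set.Finite.mem_toFinset, Set.mem_iUnion, Set.mem_ofPred_eq, exists_prop]
    constructor
    · rintro ⟨F, ⟨-, a, -, rfl⟩, hx⟩; exact hx.1
    · exact hcov x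
  inter_face := by
    intro F hF G hG
    rw [Set.Finite.mem_toFinset] at hF hG
    refine ⟨regCell_inter ω hF hG, ?_⟩
    rw [Set.inter_comm]
    exact regCell_inter ω hG hF
  face_mem := by
    intro F hF G hG hne
    rw [Set.Finite.mem_toFinset] at hF ⊢
    exact regCell_face hP ω hF hG hne

lemma full_interior {d : ℕ} {F : Set (Euc d)} (hF : Convex ℝ F) (hne : F.Nonempty)
    (hd : ¬ pdim F < d) : (interior F).Nonempty := by
  rw [hF.interior_nonempty_iff_affineSpan_eq_top,
    AffineSubspace.affineSpan_eq_top_iff_vectorSpan_eq_top_of_nonempty _ _ _ hne]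
  apply Submodule.eq_top_of_finrank_eq
  have h1 : pdim F ≤ Module.finrank ℝ (Euc d) := Submodule.finrank_le _
  have h2 : Module.finrank ℝ (Euc d) = d := Module.finrank_fin_fun ℝ
  exact le_antisymm h1 (h2.le.trans (not_lt.1 hd))

lemma aff_eq_of_interior {d : ℕ} {F : Set (Euc d)} {x : Euc d} (hx : x ∈ interior F)
    (f : Euc d →ᵃ[ℝ] ℝ) (hf : ∀ y ∈ F, 0 ≤ f y) (h0 : f x = 0) : ∀ y, f y = 0 := by
  intro y
  have hc : Continuous fun t : ℝ => x + t • (y - x) := by fun_prop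
  have h1 : ∀ᶠ t : ℝ in nhds 0, x + t • (y - x) ∈ F := by
    have h2 : F ∈ nhds (x + (0 : ℝ) • (y - x)) := by
      simpa using mem_interior_iff_mem_nhds.1 hx
    exact hc.continuousAt.eventually h2
  have h2 : ∀ᶠ t : ℝ in nhds 0, x + (-t) • (y - x) ∈ F := by
    have : Filter.Tendsto (fun t : ℝ => -t) (nhds 0) (nhds 0) := by
      simpa using (continuous_neg (G := ℝ)).tendsto 0
    exact this.eventually h1
  obtain ⟨t, ⟨k1, k2⟩, ht⟩ := (((h1.and h2).filter_mono nhdsWithin_le_nhds).and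
    (self_mem_nhdsWithin : Set.Ioi (0 : ℝ) ∈ nhdsWithin 0 (Set.Ioi 0))).exists
  have e : ∀ s : ℝ, f (x + s • (y - x)) = s * f y := by
    intro s
    have : x + s • (y - x) = (1 - s) • x + s • y := by
      rw [smul_sub, sub_smul, one_smul]; abel
    rw [this, aff_comb f x y _ _ (by ring), h0]; ring
  have e1 := hf _ k1
  have e2 := hf _ k2
  rw [e] at e1 e2
  have : t * f y = 0 := by linarith
  exact (mul_eq_zero.1 this).resolve_left (ne_of_gt ht)

lemma pachner_flip {d : ℕ} {ι : Type} [Fintype ι] [Nontrivial ι] (q : ι → Fin d → ℤ)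
    (hq : Function.Injective q)
    (J : Finset ι) (a : ι → Euc d →ᵃ[ℝ] ℝ) (h : ι → ℝ)
    (H1 : ∀ j ∈ J, ∀ i, i ≠ j → a j (intPt (q i)) = h i)
    (H2 : ∀ j ∈ J, a j (intPt (q j)) < h j)
    (cov : ∀ x ∈ convexHull ℝ (intPt '' Set.range q),
      ∃ j ∈ J, x ∈ convexHull ℝ (intPt '' (q '' {j}ᶜ))) :
    FreeAbelianGroup.of (convexHull ℝ (intPt '' Set.range q)) -
      ∑ j ∈ J, FreeAbelianGroup.of (convexHull ℝ (intPt '' (q '' {j}ᶜ)))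
      ∈ AddSubgroup.closure (relationSet d ∪ lowDimSet d) := by
  set P := convexHull ℝ (intPt '' Set.range q) with hPdef
  set Δ : ι → Set (Euc d) := fun j => convexHull ℝ (intPt '' (q '' {j}ᶜ)) with hΔ
  set N := AddSubgroup.closure (relationSet d ∪ lowDimSet d) with hN
  have hP : IsLatticePolytope P := ⟨Finset.univ.image q, by simp [hPdef]⟩
  have hqP : ∀ i, q i ∈ latticePts P := fun i => subset_convexHull ℝ _ ⟨_, ⟨i, rfl⟩, rfl⟩
  let ω : (Fin d → ℤ) → ℝ := fun v =>
    if hv : ∃ i, q i = v then h hv.choose else 1 + ∑ j ∈ J, |a j (intPt v)|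
  have ω1 : ∀ i, ω (q i) = h i := by
    intro i
    have hv : ∃ k, q k = q i := ⟨i, rfl⟩
    simp only [ω, dif_pos hv]
    rw [hq hv.choose_spec]
  have ω2 : ∀ v, (¬ ∃ i, q i = v) → ∀ j ∈ J, a j (intPt v) < ω v := by
    intro v hv j hj
    simp only [ω, dif_neg hv]
    have := Finset.single_le_sum (f := fun j => |a j (intPt v)|) (fun i _ => abs_nonneg _) hj
    have := le_abs_self (a j (intPt v))
    linarith
  have hle : ∀ j ∈ J, ∀ v ∈ latticePts P, a j (intPt v) ≤ ω v := by
    intro j hj v _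
    by_cases hv : ∃ i, q i = v
    · obtain ⟨i, rfl⟩ := hv
      rw [ω1]
      by_cases e : i = j
      · subst e; exact (H2 i hj).le
      · exact (H1 j hj i e).le
    · exact (ω2 v hv j hj).le
  have hact : ∀ j ∈ J, active P ω (a j) = q '' {j}ᶜ := by
    intro j hj
    ext v
    constructor
    · rintro ⟨-, e⟩
      by_cases hv : ∃ i, q i = v
      · obtain ⟨i, rfl⟩ := hv
        refine ⟨i, ?_, rfl⟩
        rintro rfl
        rw [ω1] at e
        exact (H2 i hj).ne e
      · exact absurd e (ω2 v hv j hj).ne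
    · rintro ⟨i, hi, rfl⟩
      exact ⟨hqP i, by rw [ω1]; exact H1 j hj i hi⟩
  have hΔcell : ∀ j ∈ J, Δ j = {x ∈ P | a j x = lowerEnv P ω x} := by
    intro j hj
    rw [cell_eq hP ω (a j) (hle j hj), hact j hj]
  have hΔreg : ∀ j ∈ J, IsRegularCell P ω (Δ j) := by
    intro j hj
    refine (regCell_iff hP ω _).2 ⟨?_, a j, hle j hj, by rw [hact j hj]⟩
    obtain ⟨i, hi⟩ := exists_ne j
    exact ⟨intPt (q i), subset_convexHull ℝ _ ⟨q i, ⟨i, hi, rfl⟩, rfl⟩⟩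
  have hinj : Set.InjOn Δ J := by
    intro j hj k hk e
    by_contra hne
    have h1 : intPt (q j) ∈ Δ k := subset_convexHull ℝ _ ⟨q j, ⟨j, hne, rfl⟩, rfl⟩
    have h2 := h1
    rw [← e, hΔcell j hj] at h2
    rw [hΔcell k hk] at h1
    have := H2 j hj
    have := H1 k hk j hne
    have := h1.2
    have := h2.2
    linarith
  let S := regSub hP ω (fun x hx => by
    obtain ⟨j, hj, hxj⟩ := cov x hx
    exact ⟨Δ j, hΔreg j hj, hxj⟩)
  have hmem : ∀ F, F ∈ S.cells ↔ IsRegularCell P ω F := fun F => Set.Finite.mem_toFinset _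
  have hrel : FreeAbelianGroup.of P - ∑ F ∈ S.cells, (if F ⊆ relBoundary P then 0
             else ((-1 : ℤ) ^ (pdim P - pdim F)) • FreeAbelianGroup.of F) ∈ N := by
    apply AddSubgroup.subset_closure
    refine Or.inl (Or.inl ⟨P, S, hP, ?_, ⟨ω, ?_⟩, rfl⟩)
    · intro F hF
      exact regCell_lattice hP ω ((hmem F).1 hF)
    · ext F; exact hmem F
  have hsum : ∑ j ∈ J, FreeAbelianGroup.of (Δ j) =
      ∑ F ∈ S.cells, if F ∈ J.image Δ then FreeAbelianGroup.of F else 0 := by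
    rw [← Finset.sum_filter, Finset.filter_mem_eq_inter, Finset.inter_eq_right.2,
      Finset.sum_image hinj]
    intro F hF
    obtain ⟨j, hj, rfl⟩ := Finset.mem_image.1 hF
    exact (hmem _).2 (hΔreg j hj)
  rw [hsum]
  have hdiff : ∑ F ∈ S.cells, ((if F ⊆ relBoundary P then 0
             else ((-1 : ℤ) ^ (pdim P - pdim F)) • FreeAbelianGroup.of F) -
             (if F ∈ J.image Δ then FreeAbelianGroup.of F else 0)) ∈ N := by
    apply AddSubgroup.sum_mem
    intro F hF
    rw [hmem] at hF
    have hlat := regCell_lattice hP ω hF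
    by_cases hd : pdim F < d
    · have hFN : FreeAbelianGroup.of F ∈ N :=
        AddSubgroup.subset_closure (Or.inr ⟨F, hlat, hd, rfl⟩)
      apply AddSubgroup.sub_mem
      · split_ifs
        · exact N.zero_mem
        · exact AddSubgroup.zsmul_mem _ hFN _
      · split_ifs
        · exact hFN
        · exact N.zero_mem
    · have hconv : Convex ℝ F := by
        obtain ⟨V, rfl⟩ := hlat
        exact convex_convexHull ℝ _
      obtain ⟨x, hx⟩ := full_interior hconv hF.1 hd
      have hxF := interior_subset hx
      obtain ⟨-, b, hb, hFb⟩ := hF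
      have hFP : F ⊆ P := by rw [hFb]; exact fun y hy => hy.1
      have c1 : ¬ F ⊆ relBoundary P := by
        intro hsub
        exact (hsub hxF).2 (interior_subset_intrinsicInterior (interior_mono hFP hx))
      have c2 : pdim P - pdim F = 0 := by
        have h1 : pdim P ≤ Module.finrank ℝ (Euc d) := Submodule.finrank_le _
        have h2 : Module.finrank ℝ (Euc d) = d := Module.finrank_fin_fun ℝ
        omega
      have c3 : F ∈ J.image Δ := by
        obtain ⟨j, hj, hxj⟩ := cov x (hFP hxF)
        have hxj' : x ∈ Δ j := hxj
        rw [hΔcell j hj] at hxj'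
        have hF1 : ∀ y ∈ F, b y = lowerEnv P ω y := by
          intro y hy; rw [hFb] at hy; exact hy.2
        have := aff_eq_of_interior hx (b - a j) (by
          intro y hy
          have h1 := (le_lowerEnv_iff hP ω (a j)).2 (hle j hj) y (hFP hy)
          rw [← hF1 y hy] at h1
          simpa using h1) (by
          simp [hF1 x hxF, hxj'.2])
        have hba : ∀ y, b y = a j y := by
          intro y
          have := this y
          simp only [AffineMap.coe_sub, Pi.sub_apply] at this
          linarith
        refine Finset.mem_image.2 ⟨j, hj, ?_⟩
        rw [hΔcell j hj, hFb]
        simp only [hba]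
      rw [if_neg c1, if_pos c3, c2]
      simp
  rw [Finset.sum_sub_distrib] at hdiff
  have := AddSubgroup.add_mem _ hrel hdiff
  convert this using 1
  abel

lemma flip_cover {d : ℕ} {ι : Type} [Fintype ι] (q : ι → Fin d → ℤ)
    (μ : ι → ℝ) (h0 : ∑ i, μ i = 0) (h1 : ∑ i, μ i • intPt (q i) = 0) (hne : ∃ i, 0 < μ i)
    (x : Euc d) (hx : x ∈ convexHull ℝ (intPt '' Set.range q)) :
    ∃ j ∈ Finset.univ.filter (fun j => 0 < μ j), x ∈ convexHull ℝ (intPt '' (q '' {j}ᶜ)) := by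
  obtain ⟨t, ht0, ht1, rfl⟩ : ∃ t : ι → ℝ, (∀ i, 0 ≤ t i) ∧ ∑ i, t i = 1 ∧
      ∑ i, t i • intPt (q i) = x := by
    have : convexHull ℝ (intPt '' Set.range q) ⊆ {x | ∃ t : ι → ℝ, (∀ i, 0 ≤ t i) ∧
        ∑ i, t i = 1 ∧ ∑ i, t i • intPt (q i) = x} := by
      apply convexHull_min
      · rintro _ ⟨_, ⟨i, rfl⟩, rfl⟩
        refine ⟨Pi.single i 1, fun k => ?_, by simp, ?_⟩
        · by_cases e : k = i
          · subst e; simp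
          · simp [e]
        · simp [Pi.single_apply, ite_smul]
      · rintro _ ⟨t, ht0, ht1, rfl⟩ _ ⟨t', ht0', ht1', rfl⟩ s s' hs hs' hss
        refine ⟨fun i => s * t i + s' * t' i, fun i => ?_, ?_, ?_⟩
        · have := mul_nonneg hs (ht0 i); have := mul_nonneg hs' (ht0' i); positivity
        · rw [Finset.sum_add_distrib, ← Finset.mul_sum, ← Finset.mul_sum, ht1, ht1']; linarith
        · simp only [add_smul, Finset.sum_add_distrib, mul_smul, Finset.smul_sum]
    exact this hx
  obtain ⟨i0, hi0⟩ := hne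
  obtain ⟨j, hj, hmin⟩ := Finset.exists_min_image (Finset.univ.filter (fun j => 0 < μ j))
    (fun i => t i / μ i) ⟨i0, by simp [hi0]⟩
  refine ⟨j, hj, ?_⟩
  have hμj : 0 < μ j := by simpa using hj
  set s := t j / μ j with hs
  have hs0 : 0 ≤ s := div_nonneg (ht0 j) hμj.le
  let u : ι → ℝ := fun i => t i - s * μ i
  have hu0 : ∀ i, 0 ≤ u i := by
    intro i
    simp only [u]
    by_cases hi : 0 < μ i
    · have := hmin i (by simp [hi])
      rw [le_div_iff₀ hi] at this
      linarith
    · have := mul_nonneg hs0 (neg_nonneg.2 (not_lt.1 hi))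
      have := ht0 i
      linarith
  have huj : u j = 0 := by
    simp only [u, hs]; field_simp; ring
  have hu1 : ∑ i, u i = 1 := by
    simp only [u, Finset.sum_sub_distrib, ← Finset.mul_sum, h0, ht1]; ring
  have hux : ∑ i, u i • intPt (q i) = ∑ i, t i • intPt (q i) := by
    simp only [u, sub_smul, Finset.sum_sub_distrib, mul_smul, ← Finset.smul_sum, h1]; simp
  rw [← hux, ← Finset.sum_erase (s := Finset.univ) (a := j) (by simp [huj])]
  apply (convex_convexHull ℝ _).sum_mem
  · intro i _; exact hu0 i
  · rw [Finset.sum_erase _ huj, hu1]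
  · intro i hi
    exact subset_convexHull ℝ _ ⟨q i, ⟨i, Finset.ne_of_mem_erase hi, rfl⟩, rfl⟩

/-- homogeneous matrix of the simplex -/
def homMat {d : ℕ} (v : Fin (d + 1) → (Fin d → ℤ)) : Matrix (Fin (d + 1)) (Fin (d + 1)) ℤ :=
  Matrix.of fun i => Fin.cons 1 (v i)

lemma homMat_det {d : ℕ} (v : Fin (d + 1) → (Fin d → ℤ)) :
    (homMat v).det = Matrix.det (Matrix.of fun i j : Fin d => v i.succ j - v 0 j) := by
  let B : Matrix (Fin (d + 1)) (Fin (d + 1)) ℤ := Matrix.of fun i =>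
    Fin.cases (Fin.cons 1 (v 0)) (fun i' => Fin.cons 0 (fun j => v i'.succ j - v 0 j)) i
  have h1 : (homMat v).det = B.det := by
    apply Matrix.det_eq_of_forall_row_eq_smul_add_const (fun i => if i = 0 then 0 else 1) 0
      (by simp)
    intro i j
    refine Fin.cases ?_ (fun i' => ?_) i <;> refine Fin.cases ?_ (fun j' => ?_) j <;>
      simp [homMat, B]
  rw [h1, Matrix.det_succ_column_zero, Fin.sum_univ_succ]
  simp [B]
  rfl

lemma normVol_eq {d : ℕ} (v : Fin (d + 1) → (Fin d → ℤ)) :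
    normVol v = (homMat v).det.natAbs := by
  rw [homMat_det]; rfl

lemma exists_nonint {m : ℕ} (M : Matrix (Fin m) (Fin m) ℤ) (hM : 2 ≤ M.det.natAbs) :
    ∃ j i, ∀ k : ℤ, (M.map (Int.cast : ℤ → ℝ))⁻¹ j i ≠ k := by
  by_contra! hcon
  choose N hN using hcon
  have hdet : (M.map (Int.cast : ℤ → ℝ)).det = (M.det : ℝ) :=
    ((Int.castRingHom ℝ).map_det M).symm
  have hu : IsUnit (M.map (Int.cast : ℤ → ℝ)).det := by
    rw [hdet, isUnit_iff_ne_zero]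
    have : M.det ≠ 0 := by intro h; simp [h] at hM
    exact_mod_cast this
  have h1 := Matrix.nonsing_inv_mul _ hu
  have h2 : (Matrix.of N).map (Int.cast : ℤ → ℝ) = (M.map (Int.cast : ℤ → ℝ))⁻¹ := by
    ext i j; simp [hN]
  have h3 := congrArg Matrix.det h1
  rw [← h2, Matrix.det_mul, hdet, Matrix.det_one] at h3
  have h4 : ((Matrix.of N).map (Int.cast : ℤ → ℝ)).det = ((Matrix.of N).det : ℝ) :=
    ((Int.castRingHom ℝ).map_det _).symm
  rw [h4] at h3
  have h5 : (Matrix.of N).det * M.det = 1 := by exact_mod_cast h3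
  have h6 := Int.isUnit_iff_natAbs_eq.1 (IsUnit.of_mul_eq_one_right _ h5)
  omega

/-- The adjustment of fractional parts. -/
lemma adjust {m : ℕ} (l : Fin m → ℝ) (z : ℤ) (hz : ∑ i, l i = z) (i0 : Fin m)
    (hi0 : ∀ k : ℤ, l i0 ≠ k) :
    ∃ c : Fin m → ℤ, (∀ i, |l i - c i| < 1) ∧ ∑ i, (l i - c i) = 1 := by
  let A : Finset (Fin m) := Finset.univ.filter fun i => Int.fract (l i) ≠ 0
  have hA0 : i0 ∈ A := by
    simp only [A, Finset.mem_filter, Finset.mem_univ, true_and]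
    intro h
    rw [Int.fract_eq_zero_iff] at h
    obtain ⟨k, hk⟩ := h
    exact hi0 k hk.symm
  have hsA : ∑ i, Int.fract (l i) = ∑ i ∈ A, Int.fract (l i) := by
    rw [Finset.sum_filter_ne_zero]
  have hsz : ∑ i, Int.fract (l i) = ((z - ∑ i, ⌊l i⌋ : ℤ) : ℝ) := by
    simp only [Int.fract, Finset.sum_sub_distrib, hz]; push_cast; rfl
  set K : ℤ := z - ∑ i, ⌊l i⌋ with hK
  have hpos : 0 < ∑ i, Int.fract (l i) := by
    rw [hsA]
    apply Finset.sum_pos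
    · intro i hi
      exact lt_of_le_of_ne (Int.fract_nonneg _) (Ne.symm (Finset.mem_filter.1 hi).2)
    · exact ⟨i0, hA0⟩
  have hlt : ∑ i, Int.fract (l i) < A.card := by
    rw [hsA]
    have := Finset.sum_lt_sum_of_nonempty (s := A) ⟨i0, hA0⟩
      (f := fun i => Int.fract (l i)) (g := fun _ => (1 : ℝ)) (fun i _ => Int.fract_lt_one _)
    simpa using this
  rw [hsz] at hpos hlt
  have hK0 : 0 < K := by exact_mod_cast hpos
  have hKA : K < A.card := by exact_mod_cast hlt
  obtain ⟨T, hTA, hT⟩ := Finset.exists_subset_card_eq (s := A) (n := (K - 1).toNat) (by omega)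
  refine ⟨fun i => ⌊l i⌋ + if i ∈ T then 1 else 0, fun i => ?_, ?_⟩
  · have h1 := Int.fract_nonneg (l i)
    have h2 := Int.fract_lt_one (l i)
    have h3 : l i = ⌊l i⌋ + Int.fract (l i) := (Int.floor_add_fract _).symm
    by_cases hi : i ∈ T
    · have h4 : 0 < Int.fract (l i) :=
        lt_of_le_of_ne h1 (Ne.symm (Finset.mem_filter.1 (hTA hi)).2)
      simp only [hi, if_true]; push_cast
      rw [abs_lt]; constructor <;> linarith
    · simp only [hi, if_false]; push_cast
      rw [abs_lt]; constructor <;> linarith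
  · have h1 : ∀ i, l i - ((⌊l i⌋ + if i ∈ T then 1 else 0 : ℤ) : ℝ) =
        Int.fract (l i) - (if i ∈ T then 1 else 0) := by
      intro i
      simp only [Int.fract]
      split_ifs <;> push_cast <;> ring
    simp only [h1, Finset.sum_sub_distrib, hsz, Finset.sum_boole]
    simp only [Finset.filter_mem_eq_inter, Finset.univ_inter, hT]
    have : (((K - 1).toNat : ℤ) : ℝ) = ((K - 1 : ℤ) : ℝ) := by
      rw [Int.toNat_of_nonneg (by omega)]
    push_cast at this ⊢
    linarith

lemma exists_point {d : ℕ} (v : Fin (d + 1) → (Fin d → ℤ)) (hV : 2 ≤ normVol v) :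
    ∃ (p : Fin d → ℤ) (l : Fin (d + 1) → ℝ) (L : Fin (d + 1) → Euc d →ᵃ[ℝ] ℝ),
      (∀ i, |l i| < 1) ∧ ∑ i, l i = 1 ∧ ∑ i, l i • intPt (v i) = intPt p ∧
      (∀ i, L i (intPt p) = l i) ∧ (∀ i k, L i (intPt (v k)) = if k = i then 1 else 0) ∧
      ∀ i, (normVol (Function.update v i p) : ℝ) = |l i| * normVol v := by
  rw [normVol_eq] at hV
  set R := (homMat v).map (Int.cast : ℤ → ℝ) with hR
  obtain ⟨j, i0, hi0⟩ := exists_nonint (homMat v) hV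
  rw [← hR] at hi0
  have hdet : R.det = ((homMat v).det : ℝ) := ((Int.castRingHom ℝ).map_det (homMat v)).symm
  have hu : IsUnit R.det := by
    rw [hdet, isUnit_iff_ne_zero]
    have : (homMat v).det ≠ 0 := by intro h; simp [h] at hV
    exact_mod_cast this
  have hinv := Matrix.nonsing_inv_mul _ hu
  have hinv' := Matrix.mul_nonsing_inv _ hu
  have hR0 : ∀ i, R i 0 = 1 := by intro i; simp [hR, homMat]
  have hRs : ∀ i (k : Fin d), R i k.succ = v i k := by intro i k; simp [hR, homMat]
  have hrow : ∀ k, ∑ i, R⁻¹ j i * R i k = if j = k then 1 else 0 := by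
    intro k
    have := congrFun (congrFun hinv j) k
    rwa [Matrix.mul_apply, Matrix.one_apply] at this
  obtain ⟨c, hc1, hc2⟩ := adjust (fun i => R⁻¹ j i) (if j = 0 then 1 else 0) (by
    have := hrow 0
    simp only [hR0, mul_one] at this
    rw [this]; split_ifs <;> simp) i0 hi0
  set l : Fin (d + 1) → ℝ := fun i => R⁻¹ j i - c i with hl
  let p : Fin d → ℤ := fun k => (if j = k.succ then 1 else 0) - ∑ i, c i * v i k
  have hp : ∀ k, ∑ i, l i * v i k = p k := by
    intro k
    have := hrow k.succ
    simp only [hRs] at this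
    simp only [hl, sub_mul, Finset.sum_sub_distrib, this, p]
    push_cast
    rfl
  let L : Fin (d + 1) → Euc d →ᵃ[ℝ] ℝ := fun i =>
    AffineMap.const ℝ _ (R⁻¹ 0 i) +
      (∑ k : Fin d, R⁻¹ k.succ i • (LinearMap.proj k : Euc d →ₗ[ℝ] ℝ)).toAffineMap
  have hL : ∀ i x, L i x = R⁻¹ 0 i + ∑ k : Fin d, R⁻¹ k.succ i * x k := by
    intro i x; simp [L]
  have hLv : ∀ i k, L i (intPt (v k)) = if k = i then 1 else 0 := by
    intro i k
    have := congrFun (congrFun hinv' k) i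
    rw [Matrix.mul_apply, Matrix.one_apply, Fin.sum_univ_succ, hR0] at this
    rw [← this, hL]
    simp only [hRs, intPt, one_mul]
    congr 1
    exact Finset.sum_congr rfl fun _ _ => mul_comm _ _
  refine ⟨p, l, L, hc1, hc2, ?_, ?_, hLv, ?_⟩
  · ext k
    simp only [Finset.sum_apply, Pi.smul_apply, smul_eq_mul, intPt]
    exact hp k
  · intro i
    have h1 : L i (intPt p) = ∑ k, l k * L i (intPt (v k)) := by
      simp only [hL, mul_add, Finset.sum_add_distrib, ← Finset.sum_mul]
      rw [show ∑ i, l i = 1 from hc2, one_mul]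
      congr 1
      simp only [Finset.mul_sum]
      rw [Finset.sum_comm]
      refine Finset.sum_congr rfl fun k _ => ?_
      simp only [intPt]
      rw [← hp k, Finset.mul_sum]
      exact Finset.sum_congr rfl fun _ _ => by ring
    rw [h1]; simp [hLv]
  · intro i
    have h2 : (homMat (Function.update v i p)).map (Int.cast : ℤ → ℝ) =
        R.updateRow i (∑ k, l k • R k) := by
      ext a b
      by_cases hai : a = i
      · subst hai
        rw [Matrix.updateRow_self]
        refine Fin.cases ?_ (fun b' => ?_) b
        · simp [homMat, hR0]; exact hc2.symm
        · simp [homMat, hRs]; exact (hp b').symm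
      · rw [Matrix.updateRow_ne hai]
        simp [homMat, hR, hai]
    have h3 : (R.updateRow i (∑ k, l k • R k)).det = l i * R.det := by
      rw [Matrix.det_updateRow_sum]
      simp
    have h4 : (((homMat (Function.update v i p)).det : ℤ) : ℝ) = l i * R.det := by
      rw [← h3, ← h2]; exact (Int.castRingHom ℝ).map_det _
    rw [normVol_eq, normVol_eq, Nat.cast_natAbs, Nat.cast_natAbs, Int.cast_abs, Int.cast_abs, h4,
      abs_mul, hdet]

lemma flip_point {d : ℕ} (v : Fin (d + 1) → (Fin d → ℤ)) (p : Fin d → ℤ)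
    (l : Fin (d + 1) → ℝ) (L : Fin (d + 1) → Euc d →ᵃ[ℝ] ℝ)
    (hl1 : ∀ i, |l i| < 1) (hl2 : ∑ i, l i = 1) (hlp : ∑ i, l i • intPt (v i) = intPt p)
    (hLp : ∀ i, L i (intPt p) = l i)
    (hLv : ∀ i k, L i (intPt (v k)) = if k = i then 1 else 0)
    (ε : ℝ) (hε : ε = 1 ∨ ε = -1) :
    FreeAbelianGroup.of (convexHull ℝ (intPt '' Set.range
        (fun o : Option (Fin (d + 1)) => o.elim p v))) -
      ((if 0 < ε then FreeAbelianGroup.of (simplexOf v) else 0) +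
        ∑ i, if 0 < -ε * l i then FreeAbelianGroup.of (simplexOf (Function.update v i p)) else 0)
      ∈ AddSubgroup.closure (relationSet d ∪ lowDimSet d) := by
  set q : Option (Fin (d + 1)) → (Fin d → ℤ) := fun o => o.elim p v with hqdef
  have hpv : ∀ k, v k ≠ p := by
    intro k e
    have h1 := hLv k k
    rw [e, hLp, if_pos rfl] at h1
    have := hl1 k
    rw [h1] at this
    simp at this
  have hq : Function.Injective q := by
    rintro (_ | i) (_ | k) e
    · rfl
    · exact absurd e.symm (hpv k)
    · exact absurd e (hpv i)
    · have e' : v i = v k := e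
      have h1 := hLv k i
      rw [e', hLv, if_pos rfl] at h1
      by_cases h : i = k
      · rw [h]
      · rw [if_neg h] at h1; exact absurd h1 one_ne_zero
  let μ : Option (Fin (d + 1)) → ℝ := fun o => o.elim ε (fun i => -ε * l i)
  have hεne : ε ≠ 0 := by rcases hε with h | h <;> rw [h] <;> norm_num
  have hεsq : ε * ε = 1 := by rcases hε with h | h <;> rw [h] <;> norm_num
  have hμ0 : ∑ o, μ o = 0 := by
    rw [Fintype.sum_option]
    simp only [μ, Option.elim, ← Finset.mul_sum, hl2]; ring
  have hμ1 : ∑ o, μ o • intPt (q o) = 0 := by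
    rw [Fintype.sum_option]
    simp only [μ, q, Option.elim, mul_smul, ← Finset.smul_sum, hlp]; simp
  have hμpos : ∃ o, 0 < μ o := by
    by_contra! hcon
    have := (Finset.sum_eq_zero_iff_of_nonpos (fun o _ => hcon o)).1 hμ0 none (Finset.mem_univ _)
    exact hεne this
  have key := pachner_flip q hq (Finset.univ.filter fun o => 0 < μ o)
    (fun o => o.elim 0 (fun i => (ε / l i) • L i)) (fun o => o.elim ε (fun _ => 0)) ?_ ?_
    (flip_cover q μ hμ0 hμ1 hμpos)
  · rw [Finset.sum_filter, Fintype.sum_option] at key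
    have e1 : convexHull ℝ (intPt '' (q '' {none}ᶜ)) = simplexOf v := by
      unfold simplexOf
      congr 1
      ext x
      constructor
      · rintro ⟨_, ⟨(_ | i), hi, rfl⟩, rfl⟩
        · exact absurd rfl hi
        · exact ⟨i, rfl⟩
      · rintro ⟨i, rfl⟩
        exact ⟨v i, ⟨some i, by simp, rfl⟩, rfl⟩
    have e2 : ∀ i, convexHull ℝ (intPt '' (q '' {some i}ᶜ)) =
        simplexOf (Function.update v i p) := by
      intro i
      unfold simplexOf
      congr 1
      ext x
      constructor
      · rintro ⟨_, ⟨(_ | k), hk, rfl⟩, rfl⟩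
        · exact ⟨i, by simp [q]⟩
        · have : k ≠ i := fun h => hk (by rw [h]; rfl)
          exact ⟨k, by simp [q, this]⟩
      · rintro ⟨k, rfl⟩
        by_cases h : k = i
        · subst h
          exact ⟨p, ⟨none, by simp, rfl⟩, by simp⟩
        · exact ⟨v k, ⟨some k, by simp [h], rfl⟩, by simp [h]⟩
    simp only [e1, e2] at key
    exact key
  · rintro (_ | j) hj (_ | i) hne
    · exact absurd rfl hne
    · simp
    · have hj' : 0 < -ε * l j := by simpa [μ] using hj
      have hlj : l j ≠ 0 := by rintro h; simp [h] at hj'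
      simp only [Option.elim, q, AffineMap.coe_smul, Pi.smul_apply, smul_eq_mul, hLp]
      field_simp
    · have : i ≠ j := fun h => hne (by rw [h])
      simp [q, hLv, this]
  · rintro (_ | j) hj
    · have hj' : 0 < ε := by simpa [μ] using hj
      simpa using hj'
    · have hj' : 0 < -ε * l j := by simpa [μ] using hj
      simp only [Option.elim, q, AffineMap.coe_smul, Pi.smul_apply, smul_eq_mul, hLv, if_true,
        mul_one]
      have : ε * l j < 0 := by linarith
      rcases mul_neg_iff.1 this with ⟨h, h'⟩ | ⟨h, h'⟩
      · exact div_neg_of_pos_of_neg h h'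
      · exact div_neg_of_neg_of_pos h h'

theorem statement6 {d : ℕ} (v : Fin (d + 1) → (Fin d → ℤ)) (hV : 2 ≤ normVol v) :
    ∃ (m : ℕ) (w : Fin m → Fin (d + 1) → (Fin d → ℤ)) (c : Fin m → ℤ),
      (∀ k, normVol (w k) ≠ 0 ∧ normVol (w k) < normVol v) ∧
      FreeAbelianGroup.of (simplexOf v)
          - ∑ k, c k • FreeAbelianGroup.of (simplexOf (w k))
        ∈ AddSubgroup.closure (relationSet d ∪ lowDimSet d) := by
  obtain ⟨p, l, L, hl1, hl2, hlp, hLp, hLv, hvol⟩ := exists_point v hV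
  have h1 := flip_point v p l L hl1 hl2 hlp hLp hLv 1 (Or.inl rfl)
  have h2 := flip_point v p l L hl1 hl2 hlp hLp hLv (-1) (Or.inr rfl)
  have hd := AddSubgroup.sub_mem _ h2 h1
  let e := Fintype.equivFin {i : Fin (d + 1) // l i ≠ 0}
  refine ⟨Fintype.card {i : Fin (d + 1) // l i ≠ 0}, fun k => Function.update v (e.symm k).1 p,
    fun k => if 0 < l (e.symm k).1 then 1 else -1, fun k => ?_, ?_⟩
  · have hv0 : (0 : ℝ) < normVol v := by
      have : 0 < normVol v := by omega
      exact_mod_cast this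
    have hk := hvol (e.symm k).1
    have hpos : 0 < |l (e.symm k).1| := abs_pos.2 (e.symm k).2
    constructor
    · have : (0 : ℝ) < normVol (Function.update v (e.symm k).1 p) := by
        rw [hk]; positivity
      have h3 : 0 < normVol (Function.update v (e.symm k).1 p) := by exact_mod_cast this
      exact h3.ne'
    · have : (normVol (Function.update v (e.symm k).1 p) : ℝ) < normVol v := by
        rw [hk]
        have := mul_lt_mul_of_pos_right (hl1 (e.symm k).1) hv0
        linarith
      exact_mod_cast this
  · rw [Equiv.sum_comp e.symm (fun i : {i : Fin (d + 1) // l i ≠ 0} =>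
      (if 0 < l i.1 then (1 : ℤ) else -1) • FreeAbelianGroup.of
        (simplexOf (Function.update v i.1 p))),
      ← Finset.sum_subtype (Finset.univ.filter fun i => l i ≠ 0) (by simp)
        (fun i => (if 0 < l i then (1 : ℤ) else -1) • FreeAbelianGroup.of
        (simplexOf (Function.update v i p))), Finset.sum_filter]
    have hs : (∑ i, if l i ≠ 0 then (if 0 < l i then (1 : ℤ) else -1) • FreeAbelianGroup.of
        (simplexOf (Function.update v i p)) else 0) =
        (∑ i, if 0 < -(-1) * l i then FreeAbelianGroup.of
          (simplexOf (Function.update v i p)) else 0) -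
        ∑ i, if 0 < -1 * l i then FreeAbelianGroup.of
          (simplexOf (Function.update v i p)) else 0 := by
      rw [← Finset.sum_sub_distrib]
      refine Finset.sum_congr rfl fun i _ => ?_
      rcases lt_trichotomy (l i) 0 with h | h | h
      · rw [if_pos h.ne, if_neg (not_lt.2 h.le), if_neg (by linarith), if_pos (by linarith)]
        simp
      · simp [h]
      · rw [if_pos h.ne', if_pos h, if_pos (by linarith), if_neg (by linarith)]
        simp
    rw [hs]
    rw [if_pos one_pos, if_neg (by norm_num)] at hd
    convert hd using 1
    abel
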